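/- arXiv:0806.0073 — 3 statements merged into one kernel-verified Lean document; each statement's English description precedes it below -/
import Mathlib

section
/- Let E be a real Banach space and let u : (0,∞) → E be strongly measurable with ∫₀^∞ (1 + |log s|)·‖u(s)‖ ds/s < ∞ and ∫₀^∞ u(s) ds/s = 0 (as a Bochner integral). Let w : (0,∞) → ℝ be integrable on (0,t) for every t > 0 with ‖w‖_W := sup_{t>0} |Pw(t) − w(t)| < ∞. Then the E-valued boundary term vanishes at both endpoints: Pw(t)·∫₀ᵗ u(s) ds/s → 0 in E as t → 0⁺, and Pw(t)·∫₀ᵗ u(s) ds/s → 0 in E as t → ∞. -/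
open MeasureTheory Set Real Filter

/-- The averaging operator `Pw(t) = (1/t) ∫₀ᵗ w(s) ds`. -/
noncomputable def Pav (w : ℝ → ℝ) (t : ℝ) : ℝ := (1 / t) * ∫ s in Ioo (0 : ℝ) t, w s

lemma Pav_aux_eq (w : ℝ → ℝ) {t : ℝ} (ht : 0 < t) :
    Pav w t = t⁻¹ * ∫ s in (0 : ℝ)..t, w s := by
  rw [Pav, intervalIntegral.integral_of_le ht.le, integral_Ioc_eq_integral_Ioo, one_div]

lemma Pav_aux_ii (w : ℝ → ℝ) (hwInt : ∀ t > (0 : ℝ), IntegrableOn w (Ioo 0 t)) {a b : ℝ}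
    (ha : 0 ≤ a) (hab : a ≤ b) : IntervalIntegrable w volume a b := by
  rw [intervalIntegrable_iff_integrableOn_Ioo_of_le hab]
  rcases eq_or_lt_of_le (ha.trans hab) with h | h
  · have : Ioo a b = ∅ := Ioo_eq_empty (by linarith)
    simp [this]
  · exact (hwInt b h).mono_set (Ioo_subset_Ioo_left ha)

lemma Pav_aux_cont (w : ℝ → ℝ) (hwInt : ∀ t > (0 : ℝ), IntegrableOn w (Ioo 0 t)) {x : ℝ}
    (hx : 0 < x) : ContinuousAt (Pav w) x := by
  have h1 : ContinuousOn (fun t => ∫ s in (0 : ℝ)..t, w s) (Icc 0 (x + 1)) := by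
    have := intervalIntegral.continuousOn_primitive_interval
      (μ := volume) (f := w) (a := 0) (b := x + 1) (by
        rw [uIcc_of_le (by linarith)]
        exact (integrableOn_Icc_iff_integrableOn_Ioo).2 (hwInt _ (by linarith)))
    rwa [uIcc_of_le (by linarith)] at this
  have h2 : ContinuousAt (fun t => ∫ s in (0 : ℝ)..t, w s) x :=
    h1.continuousAt (Icc_mem_nhds hx (by linarith))
  have h3 : ContinuousAt (fun t => t⁻¹ * ∫ s in (0 : ℝ)..t, w s) x :=
    (continuousAt_inv₀ hx.ne').mul h2
  refine h3.congr ?_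
  filter_upwards [lt_mem_nhds hx] with t ht
  exact (Pav_aux_eq w ht).symm

lemma Pav_aux_step (w : ℝ → ℝ) (C : ℝ) (hwInt : ∀ t > (0 : ℝ), IntegrableOn w (Ioo 0 t))
    (hW : ∀ t > (0 : ℝ), |Pav w t - w t| ≤ C) {x z e : ℝ} (hx : 0 < x) (hxz : x < z)
    (he : ∀ r ∈ Ioc x z, |Pav w r - Pav w x| ≤ e) :
    |Pav w z - Pav w x| ≤ (C + e) / z * (z - x) := by
  have hz := hx.trans hxz
  have hii := Pav_aux_ii w hwInt hx.le hxz.le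
  have h1 : z * (Pav w z - Pav w x) = ∫ s in x..z, (w s - Pav w x) := by
    rw [intervalIntegral.integral_sub hii (by simp), intervalIntegral.integral_const,
      ← intervalIntegral.integral_interval_sub_left (Pav_aux_ii w hwInt le_rfl hz.le)
        (Pav_aux_ii w hwInt le_rfl hx.le)]
    have e1 : (∫ s in (0 : ℝ)..z, w s) = z * Pav w z := by
      rw [Pav_aux_eq w hz]; field_simp
    have e2 : (∫ s in (0 : ℝ)..x, w s) = x * Pav w x := by
      rw [Pav_aux_eq w hx]; field_simp
    rw [e1, e2, smul_eq_mul]; ring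
  have h2 : ‖∫ s in x..z, (w s - Pav w x)‖ ≤ (C + e) * |z - x| := by
    apply intervalIntegral.norm_integral_le_of_norm_le_const
    intro s hs
    rw [uIoc_of_le hxz.le] at hs
    have a1 := abs_le.1 (hW s (hx.trans hs.1))
    have a2 := abs_le.1 (he s hs)
    rw [Real.norm_eq_abs, abs_le]
    constructor <;> linarith
  rw [← h1, Real.norm_eq_abs, abs_mul, abs_of_pos hz, abs_of_pos (sub_pos.2 hxz)] at h2
  rw [div_mul_eq_mul_div, le_div_iff₀ hz]
  linarith

lemma Pav_aux_log (w : ℝ → ℝ) (C : ℝ) (hwInt : ∀ t > (0 : ℝ), IntegrableOn w (Ioo 0 t))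
    (hW : ∀ t > (0 : ℝ), |Pav w t - w t| ≤ C) {a b : ℝ} (ha : 0 < a) (hab : a ≤ b) :
    |Pav w b - Pav w a| ≤ (C + 1) * (Real.log b - Real.log a) := by
  have key := image_norm_le_of_liminf_right_slope_norm_lt_deriv_boundary
    (f := fun t => Pav w t - Pav w a) (a := a) (b := b) (f' := fun t => C / t)
    (B := fun t => (C + 1) * (Real.log t - Real.log a)) (B' := fun t => (C + 1) * t⁻¹)
    ?_ ?_ ?_ ?_ ?_ ?_ (x := b) ⟨hab, le_rfl⟩
  · simpa using key
  · intro t ht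
    exact ((Pav_aux_cont w hwInt (ha.trans_le ht.1)).sub continuousAt_const).continuousWithinAt
  · intro x hx r hr
    have hx0 : 0 < x := ha.trans_le hx.1
    apply Eventually.frequently
    have hr' : C / x < r := hr
    rw [div_lt_iff₀ hx0] at hr'
    obtain ⟨e, he0, he⟩ : ∃ e > 0, C + e < r * x :=
      ⟨(r * x - C) / 2, by linarith, by linarith⟩
    have hz1 : ∀ᶠ z in nhds x, C + e < r * z :=
      (continuous_const.mul continuous_id).continuousAt.eventually_const_lt (by simpa using he)
    obtain ⟨d, hd, hdx⟩ := Metric.continuousAt_iff.1 (Pav_aux_cont w hwInt hx0) e he0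
    filter_upwards [self_mem_nhdsWithin, nhdsWithin_le_nhds hz1,
      nhdsWithin_le_nhds (Metric.ball_mem_nhds x hd)] with z hz hz1 hz2
    have hz : x < z := hz
    have hz0 := hx0.trans hz
    have hs := Pav_aux_step w C hwInt hW hx0 hz (e := e) (by
      intro q hq
      have := @hdx q (by
        rw [Metric.mem_ball, Real.dist_eq, abs_of_pos (by linarith)] at hz2
        rw [Real.dist_eq, abs_of_pos (by linarith [hq.1])]
        linarith [hq.2])
      rw [Real.dist_eq] at this
      exact this.le)
    have hzx : 0 < z - x := sub_pos.2 hz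
    rw [slope_def_field, div_lt_iff₀ hzx]
    have ht : ‖Pav w z - Pav w a‖ - ‖Pav w x - Pav w a‖ ≤ |Pav w z - Pav w x| := by
      refine (norm_sub_norm_le _ _).trans ?_
      rw [Real.norm_eq_abs]; simp
    have hfin : (C + e) / z * (z - x) < r * (z - x) := by
      apply mul_lt_mul_of_pos_right _ hzx
      rwa [div_lt_iff₀ hz0]
    simp only [Function.comp]
    linarith
  · simp
  · intro t ht
    have ht0 := ha.trans_le ht.1
    exact (((Real.continuousAt_log ht0.ne').sub continuousAt_const).const_mul
      (C + 1)).continuousWithinAt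
  · intro t ht
    have ht0 := ha.trans_le ht.1
    exact (((Real.hasDerivAt_log ht0.ne').sub_const _).const_mul (C + 1)).hasDerivWithinAt
  · intro t ht _
    have ht0 := ha.trans_le ht.1
    have := inv_pos.2 ht0
    show C / t < (C + 1) * t⁻¹
    rw [div_eq_mul_inv]
    nlinarith

lemma Pav_aux_bound (w : ℝ → ℝ) (C : ℝ) (hwInt : ∀ t > (0 : ℝ), IntegrableOn w (Ioo 0 t))
    (hW : ∀ t > (0 : ℝ), |Pav w t - w t| ≤ C) :
    ∃ K : ℝ, 0 ≤ K ∧ ∀ t > 0, |Pav w t| ≤ K * (1 + |Real.log t|) := by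
  have hC : 0 ≤ C := (abs_nonneg _).trans (hW 1 one_pos)
  have h0 := abs_nonneg (Pav w 1)
  refine ⟨|Pav w 1| + (C + 1), by linarith, fun t ht => ?_⟩
  have h : |Pav w t - Pav w 1| ≤ (C + 1) * |Real.log t| := by
    rcases le_total 1 t with h | h
    · have := Pav_aux_log w C hwInt hW one_pos h
      rw [Real.log_one, sub_zero] at this
      exact this.trans (mul_le_mul_of_nonneg_left (le_abs_self _) (by linarith))
    · have := Pav_aux_log w C hwInt hW ht h
      rw [Real.log_one, zero_sub, abs_sub_comm] at this
      exact this.trans (mul_le_mul_of_nonneg_left (neg_le_abs _) (by linarith))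
  have h2 : |Pav w t| ≤ |Pav w t - Pav w 1| + |Pav w 1| := by
    simpa using abs_add_le (Pav w t - Pav w 1) (Pav w 1)
  nlinarith [abs_nonneg (Real.log t)]

lemma tail_aux {ι : Type*} (l : Filter ι) [l.IsCountablyGenerated] (S : ι → Set ℝ)
    (hS : ∀ i, MeasurableSet (S i)) (f : ℝ → ℝ) (hf : IntegrableOn f (Ioi 0))
    (hsub : ∀ᶠ i in l, S i ⊆ Ioi 0) (hev : ∀ s > (0 : ℝ), ∀ᶠ i in l, s ∉ S i) :
    Tendsto (fun i => ∫ s in S i, f s) l (nhds 0) := by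
  have h := tendsto_integral_filter_of_dominated_convergence (μ := volume.restrict (Ioi 0))
    (l := l) (F := fun i => (S i).indicator f) (f := fun _ => (0 : ℝ)) (fun s => ‖f s‖)
    (Eventually.of_forall fun i => hf.aestronglyMeasurable.indicator (hS i))
    (Eventually.of_forall fun i => Eventually.of_forall fun s => norm_indicator_le_norm_self _ _)
    hf.norm
    ((ae_restrict_iff' measurableSet_Ioi).2 (Eventually.of_forall fun s hs => by
      refine tendsto_const_nhds.congr' ?_
      filter_upwards [hev s hs] with i hi
      simp [hi]))
  rw [integral_zero] at h
  refine h.congr' ?_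
  filter_upwards [hsub] with i hi
  rw [setIntegral_indicator (hS i), inter_eq_self_of_subset_right hi]

lemma term_aux {E : Type*} [NormedAddCommGroup E] [NormedSpace ℝ E]
    (u : ℝ → E) (w : ℝ → ℝ) (K t : ℝ) (hK : 0 ≤ K)
    (hu_int : IntegrableOn (fun s => (1 + |Real.log s|) * ‖u s‖ / s) (Ioi 0))
    (hP : |Pav w t| ≤ K * (1 + |Real.log t|)) (S : Set ℝ) (hS : MeasurableSet S)
    (hS0 : S ⊆ Ioi 0) (hlog : ∀ s ∈ S, |Real.log t| ≤ |Real.log s|) :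
    ‖Pav w t • ∫ s in S, s⁻¹ • u s‖ ≤ K * ∫ s in S, (1 + |Real.log s|) * ‖u s‖ / s := by
  rw [← integral_smul, ← integral_const_mul]
  refine norm_integral_le_of_norm_le ((hu_int.mono_set hS0).const_mul K) ?_
  refine (ae_restrict_iff' hS).2 (Eventually.of_forall fun s hs => ?_)
  have hs0 : 0 < s := hS0 hs
  rw [norm_smul, norm_smul, Real.norm_eq_abs, Real.norm_eq_abs, abs_of_pos (inv_pos.2 hs0)]
  have h1 : |Pav w t| ≤ K * (1 + |Real.log s|) :=
    hP.trans (mul_le_mul_of_nonneg_left (by linarith [hlog s hs]) hK)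
  have h2 : 0 ≤ s⁻¹ * ‖u s‖ := by positivity
  calc _ ≤ K * (1 + |Real.log s|) * (s⁻¹ * ‖u s‖) := mul_le_mul_of_nonneg_right h1 h2
    _ = _ := by rw [div_eq_mul_inv]; ring

/-- Vanishing of the boundary terms: if `u` has `∫₀^∞ (1+|log s|)‖u(s)‖ ds/s < ∞` and
`∫₀^∞ u(s) ds/s = 0`, and `w ∈ W`, then `Pw(t) ∫₀ᵗ u(s) ds/s → 0` as `t → 0⁺`
and as `t → ∞`. -/
theorem boundary_term_vanishes {E : Type*} [NormedAddCommGroup E] [NormedSpace ℝ E]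
    [CompleteSpace E] (u : ℝ → E) (w : ℝ → ℝ) (C : ℝ)
    (hu_meas : AEStronglyMeasurable u (volume.restrict (Ioi 0)))
    (hu_int : IntegrableOn (fun s => (1 + |Real.log s|) * ‖u s‖ / s) (Ioi 0))
    (hu_cancel : ∫ s in Ioi (0 : ℝ), s⁻¹ • u s = 0)
    (hwInt : ∀ t > (0 : ℝ), IntegrableOn w (Ioo 0 t))
    (hW : ∀ t > (0 : ℝ), |Pav w t - w t| ≤ C) :
    Tendsto (fun t : ℝ => Pav w t • ∫ s in Ioo (0 : ℝ) t, s⁻¹ • u s)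
      (nhdsWithin 0 (Ioi 0)) (nhds 0) ∧
    Tendsto (fun t : ℝ => Pav w t • ∫ s in Ioo (0 : ℝ) t, s⁻¹ • u s)
      atTop (nhds 0) := by
  obtain ⟨K, hK, hP⟩ := Pav_aux_bound w C hwInt hW
  have hui : IntegrableOn (fun s => s⁻¹ • u s) (Ioi 0) := by
    refine Integrable.mono' hu_int (measurable_inv.aestronglyMeasurable.smul hu_meas) ?_
    refine (ae_restrict_iff' measurableSet_Ioi).2 (Eventually.of_forall fun s hs => ?_)
    have hs0 : 0 < s := hs
    rw [norm_smul, Real.norm_eq_abs, abs_of_pos (inv_pos.2 hs0), div_eq_mul_inv]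
    have h2 : 0 ≤ s⁻¹ * ‖u s‖ := by positivity
    nlinarith [mul_nonneg (abs_nonneg (Real.log s)) h2]
  constructor
  · have hT := (tail_aux (nhdsWithin 0 (Ioi 0)) (fun t : ℝ => Ioo 0 t)
      (fun _ => measurableSet_Ioo) _ hu_int
      (Eventually.of_forall fun _ => Ioo_subset_Ioi_self) (fun s hs => by
        filter_upwards [nhdsWithin_le_nhds (gt_mem_nhds hs)] with t ht h
        exact absurd h.2 (not_lt.2 (le_of_lt ht)))).const_mul K
    rw [mul_zero] at hT
    refine squeeze_zero_norm' ?_ hT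
    filter_upwards [self_mem_nhdsWithin, nhdsWithin_le_nhds (gt_mem_nhds one_pos)] with t ht ht1
    have ht0 : (0 : ℝ) < t := ht
    refine term_aux u w K t hK hu_int (hP t ht) _ measurableSet_Ioo Ioo_subset_Ioi_self ?_
    intro s hs
    have h1 := Real.log_le_log hs.1 hs.2.le
    have h2 := Real.log_nonpos ht0.le (le_of_lt ht1)
    rw [abs_of_nonpos h2, abs_of_nonpos (h1.trans h2)]
    linarith
  · have hT := (tail_aux atTop (fun t : ℝ => Ici t ∩ Ioi 0)
      (fun _ => measurableSet_Ici.inter measurableSet_Ioi) _ hu_int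
      (Eventually.of_forall fun _ => inter_subset_right) (fun s hs => by
        filter_upwards [eventually_gt_atTop s] with t ht h
        exact absurd h.1 (not_le.2 ht))).const_mul K
    rw [mul_zero] at hT
    refine squeeze_zero_norm' ?_ hT
    filter_upwards [eventually_ge_atTop 1] with t ht
    have ht0 : (0 : ℝ) < t := one_pos.trans_le ht
    have hsum : (∫ s in Ioo (0 : ℝ) t, s⁻¹ • u s) = - ∫ s in Ici t ∩ Ioi 0, s⁻¹ • u s := by
      rw [eq_neg_iff_add_eq_zero, ← setIntegral_union _
        (measurableSet_Ici.inter measurableSet_Ioi) (hui.mono_set Ioo_subset_Ioi_self)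
        (hui.mono_set inter_subset_right), ← hu_cancel]
      · congr 2
        ext s
        simp only [mem_union, mem_Ioo, mem_inter_iff, mem_Ici, mem_Ioi]
        constructor
        · rintro (h | h)
          · exact h.1
          · exact h.2
        · intro h
          rcases lt_or_ge s t with h' | h'
          · exact Or.inl ⟨h, h'⟩
          · exact Or.inr ⟨h', h⟩
      · rw [Set.disjoint_left]
        intro s h1 h2
        exact absurd h2.1 (not_le.2 h1.2)
    rw [hsum, smul_neg, norm_neg]
    refine term_aux u w K t hK hu_int (hP t ht0) _
      (measurableSet_Ici.inter measurableSet_Ioi) inter_subset_right ?_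
    intro s hs
    have h1 := Real.log_le_log ht0 hs.1
    have h2 := Real.log_nonneg ht
    rwa [abs_of_nonneg h2, abs_of_nonneg (h2.trans h1)]
end

section
/- Let E be a real Banach space and let u : (0,∞) → E be strongly measurable with ∫₀^∞ (1 + |log s|)·‖u(s)‖ ds/s < ∞ and ∫₀^∞ u(s) ds/s = 0 (as a Bochner integral). Let w : (0,∞) → ℝ be integrable on (0,t) for every t > 0 with ‖w‖_W := sup_{t>0} |Pw(t) − w(t)| < ∞. Then s ↦ w(s)·u(s)/s is Bochner integrable and ∫₀^∞ w(s)·u(s) ds/s = ∫₀^∞ (w(t) − Pw(t))·[u(t) − ∫₀ᵗ u(s) ds/s] dt/t, where the right-hand integrand is Bochner integrable with respect to dt/t. (This is the 'good representation' underlying the abstract Coifman–Rochberg–Weiss commutator theorem: the unbounded weight w is replaced by the bounded function w − Pw = −w^#.) -/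
open MeasureTheory Set Real Filter

lemma pav_eq (w : ℝ → ℝ) {t : ℝ} (ht : 0 < t) : Pav w t = (∫ x in (0:ℝ)..t, w x) * t⁻¹ := by
  rw [Pav, intervalIntegral.integral_of_le ht.le, integral_Ioc_eq_integral_Ioo]
  ring

lemma w_ii (w : ℝ → ℝ) (hwInt : ∀ t > (0 : ℝ), IntegrableOn w (Ioo 0 t)) {t : ℝ} (ht : 0 < t) :
    IntervalIntegrable w volume 0 t := by
  rw [intervalIntegrable_iff_integrableOn_Ioo_of_le ht.le]
  exact hwInt t ht

lemma pav_sub (w : ℝ → ℝ) (hwInt : ∀ t > (0 : ℝ), IntegrableOn w (Ioo 0 t)) {a b : ℝ}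
    (ha : 0 < a) (hb : 0 < b) :
    IntervalIntegrable (fun t => (w t - Pav w t) / t) volume a b ∧
    ∫ t in a..b, (w t - Pav w t) / t = Pav w b - Pav w a := by
  have hm : 0 < max a b := lt_max_of_lt_left ha
  have hI := w_ii w hwInt hm
  have hsub : uIcc a b ⊆ uIcc 0 (max a b) := by
    rw [uIcc_of_le hm.le]
    intro x hx
    exact ⟨(lt_min ha hb).le.trans hx.1, hx.2⟩
  have hpos : ∀ x ∈ uIcc a b, 0 < x := fun x hx => (lt_min ha hb).trans_le hx.1
  have h1 : AbsolutelyContinuousOnInterval (fun t => ∫ x in (0:ℝ)..t, w x) a b :=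
    (hI.absolutelyContinuousOnInterval_intervalIntegral (c := 0) (by simp)).mono hsub
  have h2 : AbsolutelyContinuousOnInterval (fun t : ℝ => t⁻¹) a b := by
    apply ContDiffOn.absolutelyContinuousOnInterval
    intro x hx
    exact (contDiffAt_inv ℝ (hpos x hx).ne').contDiffWithinAt
  have h3 := h1.mul h2
  have hd : ∀ᵐ x, x ∈ uIoc a b → deriv ((fun t => ∫ x in (0:ℝ)..t, w x) * fun t : ℝ => t⁻¹) x
      = (w x - Pav w x) / x := by
    filter_upwards [hI.ae_hasDerivAt_integral] with x hx hxm
    have hxm' := uIoc_subset_uIcc hxm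
    have hx0 := hpos x hxm'
    have := (hx (hsub hxm') 0 (by simp)).mul (hasDerivAt_inv hx0.ne')
    rw [this.deriv, pav_eq w hx0]
    field_simp
    ring
  have hd' := (ae_restrict_iff' (measurableSet_uIoc)).2 hd
  constructor
  · exact h3.intervalIntegrable_deriv.congr_ae hd'
  · rw [pav_eq w ha, pav_eq w hb, ← intervalIntegral.integral_congr_ae hd]
    exact h3.integral_deriv_eq_sub

lemma inv_norm_int {s : ℝ} (hs : 0 < s) :
    IntegrableOn (fun t : ℝ => t⁻¹) (uIoc 1 s) ∧ ∫ t in uIoc 1 s, t⁻¹ = |Real.log s| := by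
  have h0 : (0:ℝ) ∉ uIcc 1 s := notMem_uIcc_of_lt one_pos hs
  have hi : IntervalIntegrable (fun t : ℝ => t⁻¹) volume 1 s :=
    intervalIntegral.intervalIntegrable_inv (fun x hx h => h0 (h ▸ hx)) continuousOn_id
  refine ⟨intervalIntegrable_iff.1 hi, ?_⟩
  have h := intervalIntegral.abs_integral_eq_abs_integral_uIoc (μ := volume) (a := 1) (b := s) (fun t : ℝ => t⁻¹)
  rw [integral_inv_of_pos one_pos hs, div_one] at h
  rw [h, abs_of_nonneg]
  apply setIntegral_nonneg measurableSet_uIoc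
  intro x hx
  exact inv_nonneg.2 ((lt_min one_pos hs).trans hx.1).le

lemma pav_bound (w : ℝ → ℝ) (C : ℝ) (hwInt : ∀ t > (0 : ℝ), IntegrableOn w (Ioo 0 t))
    (hW : ∀ t > (0 : ℝ), |Pav w t - w t| ≤ C) {s : ℝ} (hs : 0 < s) :
    |Pav w s - Pav w 1| ≤ C * |Real.log s| := by
  obtain ⟨h1, h2⟩ := pav_sub w hwInt one_pos hs
  obtain ⟨h3, h4⟩ := inv_norm_int hs
  rw [← h2, ← h4, intervalIntegral.abs_integral_eq_abs_integral_uIoc, ← integral_const_mul,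
    ← Real.norm_eq_abs]
  refine norm_integral_le_of_norm_le (h3.const_mul C) ?_
  refine (ae_restrict_iff' measurableSet_uIoc).2 (ae_of_all _ fun t ht => ?_)
  have ht0 : 0 < t := (lt_min one_pos hs).trans ht.1
  rw [norm_div, Real.norm_eq_abs, Real.norm_eq_abs, abs_of_pos ht0, div_eq_mul_inv, abs_sub_comm]
  exact mul_le_mul_of_nonneg_right (hW t ht0) (inv_pos.2 ht0).le

lemma w_meas (w : ℝ → ℝ) (hwInt : ∀ t > (0 : ℝ), IntegrableOn w (Ioo 0 t)) :
    AEStronglyMeasurable w (volume.restrict (Ioi 0)) := by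
  have : Ioi (0:ℝ) = ⋃ n : ℕ, Ioo (0:ℝ) (n+1) := by
    ext x
    simp only [mem_Ioi, mem_iUnion, mem_Ioo]
    refine ⟨fun h => ?_, fun ⟨n, h⟩ => h.1⟩
    obtain ⟨n, hn⟩ := exists_nat_gt x
    exact ⟨n, h, by linarith⟩
  rw [this, aestronglyMeasurable_iUnion_iff]
  exact fun n => (hwInt _ (by positivity)).aestronglyMeasurable

lemma pav_meas (w : ℝ → ℝ) (hwInt : ∀ t > (0 : ℝ), IntegrableOn w (Ioo 0 t)) :
    AEStronglyMeasurable (Pav w) (volume.restrict (Ioi 0)) := by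
  refine ContinuousOn.aestronglyMeasurable ?_ measurableSet_Ioi
  intro x hx
  have hx : 0 < x := hx
  have hI := w_ii w hwInt (show 0 < x + 1 by linarith)
  have hc := intervalIntegral.continuousOn_primitive_interval' hI left_mem_uIcc
  have hc' : ContinuousAt (fun t => ∫ y in (0:ℝ)..t, w y) x := by
    refine hc.continuousAt ?_
    rw [uIcc_of_le (by linarith)]
    exact Icc_mem_nhds hx (by linarith)
  have := hc'.mul (continuousAt_inv₀ hx.ne')
  refine (this.congr ?_).continuousWithinAt
  filter_upwards [Ioi_mem_nhds hx] with y hy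
  exact (pav_eq w hy).symm

/-- kernel -/
noncomputable def KK (s t : ℝ) : ℝ := (if 1 < t then 1 else 0) - (if s < t then 1 else 0)

lemma KK_eq (s t : ℝ) : KK s t = (Ioc 1 s).indicator 1 t - (Ioc s 1).indicator 1 t := by
  simp only [KK, indicator_apply, mem_Ioc, Pi.one_apply]
  grind

lemma KK_abs (s t : ℝ) : |KK s t| = (uIoc 1 s).indicator 1 t := by
  by_cases h : t ∈ uIoc 1 s
  · rw [indicator_of_mem h]
    rw [mem_uIoc] at h
    simp only [KK, Pi.one_apply]
    grind
  · rw [indicator_of_notMem h]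
    rw [mem_uIoc] at h
    simp only [KK]
    grind

lemma KK_int (g : ℝ → ℝ) {s : ℝ} (hs : 0 < s) (hg : IntervalIntegrable g volume 1 s) :
    ∫ t in Ioi (0:ℝ), KK s t * g t = ∫ t in (1:ℝ)..s, g t := by
  have e : ∀ t, KK s t * g t = (Ioc 1 s).indicator g t - (Ioc s 1).indicator g t := by
    intro t
    rw [KK_eq]
    simp only [indicator_apply, Pi.one_apply]
    split_ifs <;> ring
  simp_rw [e]
  rw [integral_sub (hg.1.integrable_indicator measurableSet_Ioc).restrict
    (hg.2.integrable_indicator measurableSet_Ioc).restrict, intervalIntegral]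
  rw [setIntegral_indicator measurableSet_Ioc, setIntegral_indicator measurableSet_Ioc,
    inter_eq_right.2, inter_eq_right.2]
  · exact fun x hx => hs.trans hx.1
  · exact fun x hx => one_pos.trans hx.1

lemma KK_meas : Measurable (fun p : ℝ × ℝ => KK p.1 p.2) := by
  unfold KK
  refine Measurable.sub (Measurable.ite ?_ measurable_const measurable_const)
    (Measurable.ite ?_ measurable_const measurable_const)
  · exact measurableSet_lt measurable_const measurable_snd
  · exact measurableSet_lt measurable_fst measurable_snd

lemma weight_integrable {E : Type*} [NormedAddCommGroup E] [NormedSpace ℝ E] (u : ℝ → E)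
    (hu_meas : AEStronglyMeasurable u (volume.restrict (Ioi 0)))
    (hu_int : IntegrableOn (fun s => (1 + |Real.log s|) * ‖u s‖ / s) (Ioi 0))
    (g : ℝ → ℝ) (A : ℝ) (hg : AEStronglyMeasurable g (volume.restrict (Ioi 0)))
    (hb : ∀ s > 0, |g s| ≤ A * (1 + |Real.log s|)) :
    IntegrableOn (fun s => (g s / s) • u s) (Ioi 0) := by
  have hinv : AEStronglyMeasurable (fun s : ℝ => s⁻¹) (volume.restrict (Ioi 0)) :=
    measurable_inv.aestronglyMeasurable
  refine Integrable.mono' (hu_int.const_mul A) ?_ ?_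
  · simp_rw [div_eq_mul_inv]
    exact (hg.mul hinv).smul hu_meas
  · refine (ae_restrict_iff' measurableSet_Ioi).2 (ae_of_all _ fun s hs => ?_)
    have hs : 0 < s := hs
    rw [norm_smul, norm_div, Real.norm_eq_abs, Real.norm_eq_abs, abs_of_pos hs]
    calc |g s| / s * ‖u s‖ ≤ A * (1 + |Real.log s|) / s * ‖u s‖ := by
          gcongr
          exact hb s hs
      _ = _ := by ring

lemma KK_u {E : Type*} [NormedAddCommGroup E] [NormedSpace ℝ E]
    (v : ℝ → E) (hv : IntegrableOn v (Ioi 0)) (h0 : ∫ s in Ioi (0:ℝ), v s = 0) (t : ℝ) :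
    ∫ s in Ioi (0:ℝ), KK s t • v s = - ∫ s in Ioo (0:ℝ) t, v s := by
  have e : ∀ s, KK s t • v s = (if 1 < t then (1:ℝ) else 0) • v s - (Iio t).indicator v s := by
    intro s
    simp only [KK, sub_smul, indicator_apply, mem_Iio]
    split_ifs <;> simp
  simp_rw [e]
  have hs : IntegrableOn (fun s => (if 1 < t then (1:ℝ) else 0) • v s) (Ioi 0) :=
    Integrable.smul _ hv
  rw [integral_sub hs (Integrable.indicator hv measurableSet_Iio),
    integral_smul, h0, smul_zero, zero_sub, setIntegral_indicator measurableSet_Iio, Ioi_inter_Iio]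

/-- The "good representation" underlying the abstract Coifman–Rochberg–Weiss theorem:
under the cancellation `∫₀^∞ u(s) ds/s = 0`,
`∫₀^∞ w(s) u(s) ds/s = ∫₀^∞ (w(t) − Pw(t)) [u(t) − ∫₀ᵗ u(s) ds/s] dt/t`. -/
theorem good_representation {E : Type*} [NormedAddCommGroup E] [NormedSpace ℝ E]
    [CompleteSpace E] (u : ℝ → E) (w : ℝ → ℝ) (C : ℝ)
    (hu_meas : AEStronglyMeasurable u (volume.restrict (Ioi 0)))
    (hu_int : IntegrableOn (fun s => (1 + |Real.log s|) * ‖u s‖ / s) (Ioi 0))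
    (hu_cancel : ∫ s in Ioi (0 : ℝ), s⁻¹ • u s = 0)
    (hwInt : ∀ t > (0 : ℝ), IntegrableOn w (Ioo 0 t))
    (hW : ∀ t > (0 : ℝ), |Pav w t - w t| ≤ C) :
    IntegrableOn (fun s => (w s / s) • u s) (Ioi 0) ∧
    IntegrableOn
      (fun t => ((w t - Pav w t) / t) • (u t - ∫ s in Ioo (0 : ℝ) t, s⁻¹ • u s))
      (Ioi 0) ∧
    ∫ s in Ioi (0 : ℝ), (w s / s) • u s =
      ∫ t in Ioi (0 : ℝ),
        ((w t - Pav w t) / t) • (u t - ∫ s in Ioo (0 : ℝ) t, s⁻¹ • u s) := by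
  have hC : 0 ≤ C := (abs_nonneg _).trans (hW 1 one_pos)
  have hwm := w_meas w hwInt
  have hpm := pav_meas w hwInt
  have hpb : ∀ s > 0, |Pav w s - Pav w 1| ≤ C * |Real.log s| :=
    fun s hs => pav_bound w C hwInt hW hs
  have hv : IntegrableOn (fun s : ℝ => s⁻¹ • u s) (Ioi 0) := by
    have := weight_integrable u hu_meas hu_int (fun _ => 1) 1 aestronglyMeasurable_const
      (fun s _ => by simp)
    simpa using this
  have hI1 := weight_integrable u hu_meas hu_int (fun s => w s - Pav w s) C (hwm.sub hpm)
    (fun s hs => by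
      rw [abs_sub_comm]
      have := hW s hs
      nlinarith [mul_nonneg hC (abs_nonneg (Real.log s))])
  have hI2 := weight_integrable u hu_meas hu_int (fun s => Pav w s - Pav w 1) C
    (hpm.sub aestronglyMeasurable_const)
    (fun s hs => (hpb s hs).trans (by nlinarith))
  have hI3 : IntegrableOn (fun s : ℝ => Pav w 1 • (s⁻¹ • u s)) (Ioi 0) := Integrable.smul _ hv
  have hdec : (fun s => (w s / s) • u s) = fun s => (((w s - Pav w s) / s) • u s
      + ((Pav w s - Pav w 1) / s) • u s) + Pav w 1 • (s⁻¹ • u s) := by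
    funext s
    rw [smul_smul, ← add_smul, ← add_smul]
    congr 1
    ring
  have hI12 : IntegrableOn (fun s => ((w s - Pav w s) / s) • u s
      + ((Pav w s - Pav w 1) / s) • u s) (Ioi 0) := hI1.add hI2
  have hfirst : IntegrableOn (fun s => (w s / s) • u s) (Ioi 0) := by
    rw [hdec]
    exact hI12.add hI3
  -- Fubini
  let F : ℝ → ℝ → E := fun s t => (KK s t * ((w t - Pav w t) / t)) • (s⁻¹ • u s)
  have hinv : AEStronglyMeasurable (fun s : ℝ => s⁻¹) (volume.restrict (Ioi 0)) :=
    measurable_inv.aestronglyMeasurable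
  have hhm : AEStronglyMeasurable (fun t => (w t - Pav w t) / t) (volume.restrict (Ioi 0)) := by
    simp_rw [div_eq_mul_inv]
    exact (hwm.sub hpm).mul hinv
  have hFm : AEStronglyMeasurable (Function.uncurry F)
      ((volume.restrict (Ioi 0)).prod (volume.restrict (Ioi 0))) :=
    (KK_meas.aestronglyMeasurable.mul hhm.comp_snd).smul hv.aestronglyMeasurable.comp_fst
  have hFb : ∀ s > 0, ∀ t > 0, ‖F s t‖ ≤
      (uIoc 1 s).indicator (fun t : ℝ => t⁻¹) t * (C * ‖s⁻¹ • u s‖) := by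
    intro s hs t ht
    have ht : 0 < t := ht
    simp only [F]
    rw [norm_smul, norm_mul, Real.norm_eq_abs, KK_abs, norm_div, Real.norm_eq_abs,
      Real.norm_eq_abs, abs_of_pos ht]
    by_cases h : t ∈ uIoc 1 s
    · rw [indicator_of_mem h, indicator_of_mem h, abs_sub_comm]
      have := mul_le_mul_of_nonneg_right (hW t ht)
        (mul_nonneg (inv_pos.2 ht).le (norm_nonneg (s⁻¹ • u s)))
      calc _ = |Pav w t - w t| * (t⁻¹ * ‖s⁻¹ • u s‖) := by
            simp only [Pi.one_apply]; ring
        _ ≤ _ := this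
        _ = _ := by ring
    · simp [indicator_of_notMem h]
  have hGi : ∀ s > 0, IntegrableOn (fun t => (uIoc 1 s).indicator (fun t : ℝ => t⁻¹) t
      * (C * ‖s⁻¹ • u s‖)) (Ioi 0) := fun s hs =>
    (((inv_norm_int hs).1.integrable_indicator measurableSet_uIoc).restrict).mul_const _
  have hGv : ∀ s > 0, ∫ t in Ioi (0:ℝ), (uIoc 1 s).indicator (fun t : ℝ => t⁻¹) t
      * (C * ‖s⁻¹ • u s‖) = |Real.log s| * (C * ‖s⁻¹ • u s‖) := by
    intro s hs
    have hs : 0 < s := hs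
    rw [integral_mul_const, setIntegral_indicator measurableSet_uIoc, inter_eq_right.2,
      (inv_norm_int hs).2]
    exact fun x hx => (lt_min one_pos hs).trans hx.1
  have hFsm : ∀ᵐ s ∂(volume.restrict (Ioi (0:ℝ))), Integrable (F s) (volume.restrict (Ioi 0)) := by
    refine (ae_restrict_iff' measurableSet_Ioi).2 (ae_of_all _ fun s hs => ?_)
    refine Integrable.mono' (hGi s hs) ?_
      ((ae_restrict_iff' measurableSet_Ioi).2 (ae_of_all _ fun t ht => hFb s hs t ht))
    have : Measurable (fun t => KK s t) := KK_meas.comp measurable_prodMk_left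
    exact (this.aestronglyMeasurable.mul hhm).smul aestronglyMeasurable_const
  have hFi : Integrable (Function.uncurry F)
      ((volume.restrict (Ioi 0)).prod (volume.restrict (Ioi 0))) := by
    rw [integrable_prod_iff hFm]
    refine ⟨hFsm, ?_⟩
    refine Integrable.mono' (hu_int.const_mul C) hFm.norm.integral_prod_right' ?_
    refine (ae_restrict_iff' measurableSet_Ioi).2 (ae_of_all _ fun s hs => ?_)
    have hs0 : 0 < s := hs
    rw [Real.norm_of_nonneg (integral_nonneg fun _ => norm_nonneg _)]
    calc ∫ t in Ioi (0:ℝ), ‖F s t‖ ≤ |Real.log s| * (C * ‖s⁻¹ • u s‖) := by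
          rw [← hGv s hs]
          refine integral_mono_of_nonneg (ae_of_all _ fun _ => norm_nonneg _) (hGi s hs)
            ((ae_restrict_iff' measurableSet_Ioi).2 (ae_of_all _ fun t ht => hFb s hs t ht))
      _ ≤ C * ((1 + |Real.log s|) * ‖u s‖ / s) := by
          rw [norm_smul, norm_inv, Real.norm_eq_abs, abs_of_pos hs0]
          have : 0 ≤ C * (‖u s‖ * s⁻¹) := by positivity
          rw [div_eq_mul_inv]
          nlinarith
  have hFs : ∀ s > 0, ∫ t in Ioi (0:ℝ), F s t = ((Pav w s - Pav w 1) / s) • u s := by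
    intro s hs
    obtain ⟨h1, h2⟩ := pav_sub w hwInt one_pos hs
    simp only [F]
    rw [integral_smul_const, KK_int _ hs h1, h2, smul_smul, div_eq_mul_inv]
  have hFt : ∀ t, ∫ s in Ioi (0:ℝ), F s t
      = - (((w t - Pav w t) / t) • ∫ s in Ioo (0 : ℝ) t, s⁻¹ • u s) := by
    intro t
    rw [← smul_neg, ← KK_u _ hv hu_cancel t, ← integral_smul]
    congr 1
    funext s
    simp only [F]
    rw [mul_comm, mul_smul]
  have hR : IntegrableOn (fun t => - (((w t - Pav w t) / t) • ∫ s in Ioo (0 : ℝ) t, s⁻¹ • u s))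
      (Ioi 0) := by
    have := hFi.integral_prod_right
    simp only [Function.uncurry_apply_pair, hFt] at this
    exact this
  have hswap := integral_integral_swap hFi
  simp only [hFt] at hswap
  rw [setIntegral_congr_fun measurableSet_Ioi hFs] at hswap
  have hrhs : (fun t => ((w t - Pav w t) / t) • (u t - ∫ s in Ioo (0 : ℝ) t, s⁻¹ • u s))
      = fun t => ((w t - Pav w t) / t) • u t
        + - (((w t - Pav w t) / t) • ∫ s in Ioo (0 : ℝ) t, s⁻¹ • u s) := by
    funext t
    rw [smul_sub, sub_eq_add_neg]
  refine ⟨hfirst, ?_, ?_⟩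
  · rw [hrhs]
    exact hI1.add hR
  · rw [hrhs, hdec, integral_add hI12 hI3, integral_add hI1 hI2, integral_add hI1 hR, hswap,
      integral_smul, hu_cancel, smul_zero, add_zero]
end

section
/- Let E be a real Banach space and let u : (0,∞) → E be strongly measurable with ∫₀^∞ (1 + |log s|)²·‖u(s)‖ ds/s < ∞, ∫₀^∞ u(s) ds/s = 0, and ∫₀^∞ Pw(s)·u(s) ds/s = 0 (Bochner integrals). Let w : (0,∞) → ℝ be integrable on (0,t) for every t > 0 with ‖w‖_W := sup_{t>0} |Pw(t) − w(t)| < ∞. Then s ↦ (Pw(s))²·u(s)/s is Bochner integrable and ∫₀^∞ (Pw(s))²·u(s) ds/s = 2·∫₀^∞ (Pw(t) − w(t))·( ∫₀ᵗ (Pw(r) − w(r))·(∫₀^r u(s) ds/s) dr/r ) dt/t, all integrals being absolutely convergent Bochner integrals. (This is the second-order cancellation identity underlying the paper's higher-order representation theorem.) -/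
open MeasureTheory Set Real Filter

lemma Pav_eq (w : ℝ → ℝ) {t : ℝ} (ht : 0 < t) : Pav w t = t⁻¹ * ∫ s in (0:ℝ)..t, w s := by
  rw [Pav, intervalIntegral.integral_of_le ht.le, integral_Ioc_eq_integral_Ioo, one_div]

lemma Pav_ac (w : ℝ → ℝ) (hwInt : ∀ t > (0 : ℝ), IntegrableOn w (Ioo 0 t))
    {x y : ℝ} (hx : 0 < x) (hy : 0 < y) :
    AbsolutelyContinuousOnInterval (fun t => t⁻¹ * ∫ s in (0:ℝ)..t, w s) x y ∧
    ∀ᵐ t, t ∈ uIcc x y →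
      HasDerivAt (fun t => t⁻¹ * ∫ s in (0:ℝ)..t, w s) (-((Pav w t - w t) / t)) t := by
  have hm : 0 < max x y := lt_max_of_lt_left hx
  have hpos : ∀ t ∈ uIcc x y, 0 < t := fun t ht => lt_of_lt_of_le (lt_min hx hy) ht.1
  have hI : IntervalIntegrable w volume 0 (max x y) := by
    rw [intervalIntegrable_iff_integrableOn_Ioo_of_le hm.le]
    exact hwInt _ hm
  have hsub : uIcc x y ⊆ uIcc 0 (max x y) := by
    intro t ht
    rw [uIcc_of_le hm.le]
    exact ⟨(hpos t ht).le, ht.2⟩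
  constructor
  · have h1 : AbsolutelyContinuousOnInterval (fun t : ℝ => t⁻¹) x y := by
      apply ContDiffOn.absolutelyContinuousOnInterval
      apply ContDiffOn.inv contDiffOn_id
      intro t ht
      exact (hpos t ht).ne'
    have h2 := (hI.absolutelyContinuousOnInterval_intervalIntegral (c := 0) (by simp)).mono hsub
    exact h1.fun_mul h2
  · filter_upwards [hI.ae_hasDerivAt_integral] with t ht htm
    have h := ht (hsub htm) 0 (by simp)
    have h0 := hpos t htm
    have h2 := (hasDerivAt_inv h0.ne').mul h
    convert! h2 using 1
    rw [Pav_eq w h0]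
    field_simp
    ring

lemma ftc1 (w : ℝ → ℝ) (hwInt : ∀ t > (0 : ℝ), IntegrableOn w (Ioo 0 t))
    {x y : ℝ} (hx : 0 < x) (hy : 0 < y) :
    ∫ r in x..y, (Pav w r - w r) / r = Pav w x - Pav w y := by
  obtain ⟨h1, h2⟩ := Pav_ac w hwInt hx hy
  have h3 := h1.integral_deriv_eq_sub
  rw [Pav_eq w hx, Pav_eq w hy, ← neg_sub, ← h3, ← intervalIntegral.integral_neg]
  apply intervalIntegral.integral_congr_ae
  filter_upwards [h2] with t ht htm
  rw [(ht (uIoc_subset_uIcc htm)).deriv, neg_neg]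

lemma ftc2 (w : ℝ → ℝ) (hwInt : ∀ t > (0 : ℝ), IntegrableOn w (Ioo 0 t))
    {x y : ℝ} (hx : 0 < x) (hy : 0 < y) :
    ∫ t in x..y, (Pav w t - w t) / t * (Pav w x - Pav w t) = (Pav w x - Pav w y) ^ 2 / 2 := by
  have hpos : ∀ t ∈ uIcc x y, 0 < t := fun t ht => lt_of_lt_of_le (lt_min hx hy) ht.1
  obtain ⟨h1, h2⟩ := Pav_ac w hwInt hx hy
  have hc : AbsolutelyContinuousOnInterval (fun _ : ℝ => Pav w x) x y :=
    contDiffOn_const.absolutelyContinuousOnInterval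
  have h := hc.fun_sub h1
  have h3 := h.integral_deriv_mul_eq_sub h
  have e : ∀ f : ℝ → ℝ, ∫ t in x..y, f t = (∫ t in x..y, 2 * f t) / 2 := by
    intro f
    rw [intervalIntegral.integral_const_mul]; ring
  rw [e]
  congr 1
  simp only [← Pav_eq w hx, ← Pav_eq w hy] at h3
  trans (Pav w x - Pav w y) * (Pav w x - Pav w y) - (Pav w x - Pav w x) * (Pav w x - Pav w x)
  · rw [← h3]
    apply intervalIntegral.integral_congr_ae
    filter_upwards [h2] with t ht htm
    have htm := uIoc_subset_uIcc htm
    rw [((hasDerivAt_const t (Pav w x)).fun_sub (ht htm)).deriv, ← Pav_eq w (hpos t htm)]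
    ring
  · ring

lemma Pav_cont (w : ℝ → ℝ) (hwInt : ∀ t > (0 : ℝ), IntegrableOn w (Ioo 0 t)) :
    ContinuousOn (Pav w) (Ioi 0) := by
  intro t ht
  have ht : 0 < t := ht
  have h := (Pav_ac w hwInt (x := t / 2) (y := 2 * t) (by linarith) (by linarith)).1.continuousOn
  have hu : uIcc (t/2) (2*t) ∈ nhds t := by
    rw [uIcc_of_le (by linarith)]
    exact Icc_mem_nhds (by linarith) (by linarith)
  have h2 := h.continuousAt hu
  refine (h2.congr ?_).continuousWithinAt
  filter_upwards [Ioi_mem_nhds ht] with s hs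
  rw [Pav_eq w hs]

lemma Pav_lip (w : ℝ → ℝ) (C : ℝ) (hwInt : ∀ t > (0 : ℝ), IntegrableOn w (Ioo 0 t))
    (hW : ∀ t > (0 : ℝ), |Pav w t - w t| ≤ C)
    {x y : ℝ} (hx : 0 < x) (hy : 0 < y) :
    |Pav w x - Pav w y| ≤ C * |Real.log x - Real.log y| := by
  wlog hxy : x ≤ y generalizing x y
  · rw [abs_sub_comm, abs_sub_comm (Real.log x)]
    exact this hy hx (by linarith)
  rw [← ftc1 w hwInt hx hy]
  have hC : (∫ r in x..y, C * r⁻¹) = C * |Real.log x - Real.log y| := by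
    rw [intervalIntegral.integral_const_mul, integral_inv_of_pos hx hy,
      Real.log_div hy.ne' hx.ne', abs_sub_comm, abs_of_nonneg]
    have := Real.log_le_log hx hxy
    linarith
  rw [← hC, ← Real.norm_eq_abs]
  apply intervalIntegral.norm_integral_le_of_norm_le hxy
  · filter_upwards with t ht
    have h0 : 0 < t := hx.trans ht.1
    rw [norm_div, Real.norm_eq_abs, Real.norm_eq_abs, abs_of_pos h0, div_eq_mul_inv]
    gcongr
    exact hW t h0
  · apply IntervalIntegrable.const_mul
    apply intervalIntegral.intervalIntegrable_inv
    · intro t ht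
      exact (lt_of_lt_of_le (lt_min hx hy) ht.1).ne'
    · exact continuousOn_id

lemma integral_inv_uIoc {s c : ℝ} (hs : 0 < s) (hc : 0 < c) :
    IntegrableOn (fun t : ℝ => t⁻¹) (uIoc s c) ∧ ∫ t in uIoc s c, t⁻¹ = |Real.log s - Real.log c| := by
  wlog h : s ≤ c generalizing s c
  · rw [uIoc_comm, abs_sub_comm]
    exact this hc hs (by linarith)
  constructor
  · rw [← intervalIntegrable_iff]
    apply intervalIntegral.intervalIntegrable_inv
    · intro t ht
      exact (lt_of_lt_of_le (lt_min hs hc) ht.1).ne'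
    · exact continuousOn_id
  · rw [uIoc_of_le h, ← intervalIntegral.integral_of_le h, integral_inv_of_pos hs hc,
      Real.log_div hc.ne' hs.ne', abs_sub_comm, abs_of_nonneg]
    have := Real.log_le_log hs h
    linarith

/-- The sign kernel. -/
noncomputable def Jker (c s t : ℝ) : ℝ :=
  (Ioc s c).indicator (fun _ => 1) t - (Ioc c s).indicator (fun _ => 1) t

lemma Jker_meas (c : ℝ) : Measurable (fun p : ℝ × ℝ => Jker c p.1 p.2) := by
  unfold Jker
  apply Measurable.sub
  · have : MeasurableSet {p : ℝ × ℝ | p.1 < p.2 ∧ p.2 ≤ c} :=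
      (measurableSet_lt measurable_fst measurable_snd).inter
        (measurableSet_le measurable_snd measurable_const)
    convert! measurable_const.indicator this (f := fun _ => (1:ℝ)) using 1
  · have : MeasurableSet {p : ℝ × ℝ | c < p.2 ∧ p.2 ≤ p.1} :=
      (measurableSet_lt measurable_const measurable_snd).inter
        (measurableSet_le measurable_snd measurable_fst)
    convert! measurable_const.indicator this (f := fun _ => (1:ℝ)) using 1

lemma Jker_abs (c s t : ℝ) : |Jker c s t| = (uIoc s c).indicator (fun _ => (1:ℝ)) t := by
  unfold Jker
  have hm : t ∈ uIoc s c ↔ (s < t ∧ t ≤ c) ∨ (c < t ∧ t ≤ s) := mem_uIoc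
  by_cases h1 : s < t ∧ t ≤ c <;> by_cases h2 : c < t ∧ t ≤ s <;>
    simp [indicator_apply, hm, h1, h2]
  linarith [h1.2, h2.1]

lemma Jker_le {c s t : ℝ} (h : t ≤ c) : Jker c s t = (Iio t).indicator (fun _ => (1:ℝ)) s := by
  unfold Jker
  simp [indicator_apply, h]

lemma Jker_gt {c s t : ℝ} (h : c < t) : Jker c s t = - (Ici t).indicator (fun _ => (1:ℝ)) s := by
  unfold Jker
  simp [indicator_apply, h]

lemma keyG {E : Type*} [NormedAddCommGroup E] [NormedSpace ℝ E] [CompleteSpace E]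
    (k : ℝ → ℝ → ℝ) (v : ℝ → E) (M : ℝ → ℝ) {c : ℝ} (hc : 0 < c)
    (hk : AEStronglyMeasurable (fun p : ℝ × ℝ => k p.1 p.2)
      ((volume.restrict (Ioi 0)).prod (volume.restrict (Ioi 0))))
    (hv : AEStronglyMeasurable v (volume.restrict (Ioi 0)))
    (hM : ∀ s > 0, ∀ t ∈ uIoc s c, |k s t| ≤ M s * t⁻¹)
    (hMint : IntegrableOn (fun s => M s * |Real.log s - Real.log c| * ‖v s‖) (Ioi 0))
    (hi : ∀ t > 0, IntegrableOn (fun s => k s t • v s) (Ioi 0))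
    (h0 : ∀ t > 0, ∫ s in Ioi (0:ℝ), k s t • v s = 0) :
    IntegrableOn (fun t => ∫ s in Ioo 0 t, k s t • v s) (Ioi 0) ∧
    ∫ t in Ioi (0:ℝ), ∫ s in Ioo 0 t, k s t • v s =
      ∫ s in Ioi (0:ℝ), (∫ t in s..c, k s t) • v s := by
  set μ := (volume.restrict (Ioi (0:ℝ))) with hμ
  let F : ℝ × ℝ → E := fun p => (Jker c p.1 p.2 * k p.1 p.2) • v p.1
  have hJk : AEStronglyMeasurable (fun p : ℝ × ℝ => Jker c p.1 p.2 * k p.1 p.2) (μ.prod μ) :=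
    (Jker_meas c).aestronglyMeasurable.mul hk
  have hF : AEStronglyMeasurable F (μ.prod μ) := hJk.smul hv.comp_fst
  have hsec : ∀ᵐ s ∂μ, AEStronglyMeasurable (fun t => Jker c s t * k s t) μ := hJk.prodMk_left
  have hpos : ∀ᵐ s ∂μ, 0 < s := ae_restrict_mem measurableSet_Ioi
  have hsubI : ∀ s > 0, uIoc s c ⊆ Ioi 0 := fun s hs t ht => lt_trans (lt_min hs hc) ht.1
  have hbd : ∀ s > 0, ∀ t, ‖Jker c s t * k s t‖ ≤ (uIoc s c).indicator (fun t => M s * t⁻¹) t := by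
    intro s hs t
    rw [norm_mul, Real.norm_eq_abs, Jker_abs]
    by_cases ht : t ∈ uIoc s c
    · simpa [ht] using hM s hs t ht
    · simp [ht]
  have hbdi : ∀ s > 0, Integrable ((uIoc s c).indicator (fun t => M s * t⁻¹)) μ := by
    intro s hs
    rw [integrable_indicator_iff measurableSet_uIoc]
    exact (((integral_inv_uIoc hs hc).1).const_mul _).mono_measure
      (Measure.restrict_mono le_rfl Measure.restrict_le_self)
  have hbdI : ∀ s > 0, ∫ t, (uIoc s c).indicator (fun t => M s * t⁻¹) t ∂μ
      = M s * |Real.log s - Real.log c| := by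
    intro s hs
    rw [integral_indicator measurableSet_uIoc, hμ, Measure.restrict_restrict measurableSet_uIoc,
      inter_eq_left.mpr (hsubI s hs), integral_const_mul, (integral_inv_uIoc hs hc).2]
  have hki : ∀ᵐ s ∂μ, Integrable (fun t => Jker c s t * k s t) μ := by
    filter_upwards [hsec, hpos] with s h1 h2
    exact (hbdi s h2).mono' h1 (Eventually.of_forall (hbd s h2))
  have hFi : Integrable F (μ.prod μ) := by
    rw [integrable_prod_iff hF]
    constructor
    · filter_upwards [hki] with s h1
      exact h1.smul_const (v s)
    · refine Integrable.mono' hMint hF.norm.integral_prod_right' ?_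
      filter_upwards [hki, hpos] with s h1 h2
      simp only [F, norm_smul]
      rw [integral_mul_const, norm_mul, norm_norm, ← hbdI s h2]
      gcongr
      rw [Real.norm_of_nonneg (by positivity)]
      exact integral_mono_of_nonneg (Eventually.of_forall fun _ => norm_nonneg _) (hbdi s h2)
        (Eventually.of_forall (hbd s h2))
  have hH : ∀ t > 0, ∫ s, F (s, t) ∂μ = ∫ s in Ioo 0 t, k s t • v s := by
    intro t ht
    have hlow : ∫ s, (Iio t).indicator (fun s => k s t • v s) s ∂μ
        = ∫ s in Ioo 0 t, k s t • v s := by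
      rw [integral_indicator measurableSet_Iio, hμ, Measure.restrict_restrict measurableSet_Iio,
        inter_comm, Ioi_inter_Iio]
    rw [← hlow]
    rcases le_or_gt t c with h | h
    · congr 1
      ext s
      simp only [F, Jker_le h, indicator_apply]
      split_ifs <;> simp
    · have h2 := integral_add_compl (μ := μ) (measurableSet_Iio (a := t)) (hi t ht)
      rw [h0 t ht, ← integral_indicator measurableSet_Iio,
        ← integral_indicator measurableSet_Iio.compl] at h2
      rw [eq_neg_of_add_eq_zero_left h2, ← integral_neg]
      congr 1
      ext s
      simp only [F, Jker_gt h, indicator_apply, compl_Iio]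
      split_ifs <;> simp
  have hT : ∀ s > 0, Integrable (fun t => Jker c s t * k s t) μ →
      ∫ t, F (s, t) ∂μ = (∫ t in s..c, k s t) • v s := by
    intro s hs h1
    simp only [F]
    rw [integral_smul_const]
    congr 1
    rcases le_total s c with h | h
    · have : Ioc s c ⊆ Ioi 0 := fun t ht => hs.trans ht.1
      rw [intervalIntegral.integral_of_le h, ← inter_eq_left.mpr this,
        ← Measure.restrict_restrict measurableSet_Ioc, ← integral_indicator measurableSet_Ioc]
      congr 1
      ext t
      simp [Jker, h, indicator_apply]
    · have : Ioc c s ⊆ Ioi 0 := fun t ht => hc.trans ht.1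
      rw [intervalIntegral.integral_of_ge h, ← inter_eq_left.mpr this,
        ← Measure.restrict_restrict measurableSet_Ioc, ← integral_indicator measurableSet_Ioc,
        ← integral_neg]
      congr 1
      ext t
      simp [Jker, h, indicator_apply]
  have hHae : (fun t => ∫ s, F (s, t) ∂μ) =ᵐ[μ] fun t => ∫ s in Ioo 0 t, k s t • v s := by
    filter_upwards [hpos] with t ht using hH t ht
  constructor
  · exact hFi.integral_prod_right.congr hHae
  · rw [← integral_congr_ae hHae, ← integral_integral_swap (f := fun s t => F (s, t)) hFi]
    apply integral_congr_ae
    filter_upwards [hpos, hki] with s hs h1 using hT s hs h1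

lemma dom {E : Type*} [NormedAddCommGroup E] [NormedSpace ℝ E] (u : ℝ → E)
    (hu_meas : AEStronglyMeasurable u (volume.restrict (Ioi 0)))
    (hu_int : IntegrableOn (fun s => (1 + |Real.log s|) ^ 2 * ‖u s‖ / s) (Ioi 0))
    (g : ℝ → ℝ) (K : ℝ) (hg : AEStronglyMeasurable g (volume.restrict (Ioi 0)))
    (hb : ∀ s > 0, |g s| ≤ K * (1 + |Real.log s|) ^ 2) :
    IntegrableOn (fun s => g s • (s⁻¹ • u s)) (Ioi 0) := by
  refine Integrable.mono' (hu_int.const_mul K) ?_ ?_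
  · exact hg.smul (measurable_inv.aestronglyMeasurable.smul hu_meas)
  · filter_upwards [ae_restrict_mem measurableSet_Ioi] with s hs
    have hs : 0 < s := hs
    rw [norm_smul, norm_smul, Real.norm_eq_abs, norm_inv, Real.norm_of_nonneg hs.le]
    calc |g s| * (s⁻¹ * ‖u s‖) ≤ (K * (1 + |Real.log s|) ^ 2) * (s⁻¹ * ‖u s‖) := by
          gcongr; exact hb s hs
      _ = _ := by ring

/-- Second-order cancellation identity: under the cancellations `∫₀^∞ u(s) ds/s = 0`
and `∫₀^∞ Pw(s) u(s) ds/s = 0`,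
`∫₀^∞ (Pw(s))² u(s) ds/s
  = 2 ∫₀^∞ (Pw(t) − w(t)) (∫₀ᵗ (Pw(r) − w(r)) (∫₀ʳ u(s) ds/s) dr/r) dt/t`. -/
theorem second_order_cancellation {E : Type*} [NormedAddCommGroup E] [NormedSpace ℝ E]
    [CompleteSpace E] (u : ℝ → E) (w : ℝ → ℝ) (C : ℝ)
    (hu_meas : AEStronglyMeasurable u (volume.restrict (Ioi 0)))
    (hu_int : IntegrableOn (fun s => (1 + |Real.log s|) ^ 2 * ‖u s‖ / s) (Ioi 0))
    (hu_cancel : ∫ s in Ioi (0 : ℝ), s⁻¹ • u s = 0)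
    (hu_cancel' : ∫ s in Ioi (0 : ℝ), (Pav w s / s) • u s = 0)
    (hwInt : ∀ t > (0 : ℝ), IntegrableOn w (Ioo 0 t))
    (hW : ∀ t > (0 : ℝ), |Pav w t - w t| ≤ C) :
    IntegrableOn (fun s => ((Pav w s) ^ 2 / s) • u s) (Ioi 0) ∧
    IntegrableOn
      (fun r => ((Pav w r - w r) / r) • ∫ s in Ioo (0 : ℝ) r, s⁻¹ • u s) (Ioi 0) ∧
    IntegrableOn
      (fun t => ((Pav w t - w t) / t) •
        ∫ r in Ioo (0 : ℝ) t, ((Pav w r - w r) / r) • ∫ s in Ioo (0 : ℝ) r, s⁻¹ • u s)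
      (Ioi 0) ∧
    ∫ s in Ioi (0 : ℝ), ((Pav w s) ^ 2 / s) • u s =
      (2 : ℝ) • ∫ t in Ioi (0 : ℝ), ((Pav w t - w t) / t) •
        ∫ r in Ioo (0 : ℝ) t, ((Pav w r - w r) / r) • ∫ s in Ioo (0 : ℝ) r, s⁻¹ • u s := by
  have hC : 0 ≤ C := (abs_nonneg _).trans (hW 1 one_pos)
  set A := Pav w with hA
  let v : ℝ → E := fun s => s⁻¹ • u s
  have hAm : AEStronglyMeasurable A (volume.restrict (Ioi 0)) :=
    (Pav_cont w hwInt).aestronglyMeasurable measurableSet_Ioi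
  have ham : AEStronglyMeasurable (fun t => (A t - w t) / t) (volume.restrict (Ioi 0)) := by
    simp only [div_eq_mul_inv]
    exact (hAm.sub (w_meas w hwInt)).mul measurable_inv.aestronglyMeasurable
  have hvm : AEStronglyMeasurable v (volume.restrict (Ioi 0)) :=
    measurable_inv.aestronglyMeasurable.smul hu_meas
  have hlip : ∀ {x y : ℝ}, 0 < x → 0 < y → |A x - A y| ≤ C * |Real.log x - Real.log y| :=
    fun hx hy => Pav_lip w C hwInt hW hx hy
  have hab : ∀ t > 0, |(A t - w t) / t| ≤ C * t⁻¹ := by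
    intro t ht
    rw [abs_div, abs_of_pos ht, div_eq_mul_inv]
    gcongr
    exact hW t ht
  have hdom := dom u hu_meas hu_int
  have hlog0 : ∀ s : ℝ, 0 ≤ |Real.log s| := fun s => abs_nonneg _
  obtain ⟨K, hK0, hK⟩ : ∃ K, 0 ≤ K ∧ ∀ s > 0, |A s| ≤ K * (1 + |Real.log s|) := by
    refine ⟨|A 1| + C, by positivity, fun s hs => ?_⟩
    have h1 := hlip hs one_pos
    rw [Real.log_one, sub_zero] at h1
    have h2 : |A s| ≤ |A s - A 1| + |A 1| := by simpa using abs_add_le (A s - A 1) (A 1)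
    have h3 : 0 ≤ |A 1| * |Real.log s| := by positivity
    nlinarith
  have hone : ∀ s : ℝ, (1 + |Real.log s|) ≤ (1 + |Real.log s|) ^ 2 := fun s => by
    nlinarith [hlog0 s]
  have hvi : IntegrableOn v (Ioi 0) := by
    have := hdom (fun _ => 1) 1 aestronglyMeasurable_const (fun s hs => by
      have := hone s; have := hlog0 s; simp only [abs_one]; linarith)
    simpa [v] using this
  have hAvi : IntegrableOn (fun s => A s • v s) (Ioi 0) :=
    hdom A K hAm (fun s hs => (hK s hs).trans (by gcongr; exact hone s))
  have hA2vi : IntegrableOn (fun s => (A s) ^ 2 • v s) (Ioi 0) := by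
    refine hdom _ (K ^ 2) (hAm.pow 2) (fun s hs => ?_)
    rw [abs_pow, ← mul_pow]
    gcongr
    exact hK s hs
  have hAv0 : ∫ s in Ioi (0:ℝ), A s • v s = 0 := by
    rw [← hu_cancel']
    simp only [v, smul_smul, div_eq_mul_inv]
  have hlogm : ∀ c : ℝ, AEStronglyMeasurable (fun s => Real.log s - Real.log c)
      (volume.restrict (Ioi 0)) := fun c =>
    (Real.measurable_log.sub measurable_const).aestronglyMeasurable
  -- integrability of `C |log s - log c| ‖v‖`
  have hMint1 : ∀ c > 0, IntegrableOn (fun s => C * |Real.log s - Real.log c| * ‖v s‖) (Ioi 0) := by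
    intro c hc
    have := hdom (fun s => C * (Real.log s - Real.log c)) (C * (1 + |Real.log c|))
      ((hlogm c).const_mul C) (fun s hs => ?_)
    · refine this.norm.congr (Eventually.of_forall fun s => ?_)
      simp only [norm_smul, v, norm_mul, Real.norm_eq_abs, abs_of_nonneg hC]
    · rw [abs_mul, abs_of_nonneg hC, mul_assoc]
      gcongr
      have h1 := abs_sub (Real.log s) (Real.log c)
      have h3 := hlog0 s
      have h4 := hlog0 c
      nlinarith [mul_nonneg h3 h4, hone s, mul_nonneg (mul_nonneg h3 h4) h3]
  have hMint2 : IntegrableOn (fun s => (C * (C * |Real.log s - Real.log 1|)) *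
      |Real.log s - Real.log 1| * ‖v s‖) (Ioi 0) := by
    have := hdom (fun s => C ^ 2 * (Real.log s - Real.log 1) ^ 2) (C ^ 2)
      (((hlogm 1).pow 2).const_mul _) (fun s hs => ?_)
    · refine this.norm.congr (Eventually.of_forall fun s => ?_)
      simp only [norm_smul, v, norm_mul, Real.norm_eq_abs, abs_of_nonneg hC, norm_pow]
      ring
    · rw [Real.log_one, sub_zero, abs_of_nonneg (by positivity), ← sq_abs (Real.log s)]
      gcongr
      linarith
  -- first-order integrability
  have hU : IntegrableOn (fun r => ((A r - w r) / r) • ∫ s in Ioo (0 : ℝ) r, v s) (Ioi 0) := by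
    have h := (keyG (fun _ t => (A t - w t) / t) v (fun _ => C) one_pos ham.comp_snd hvm
      (fun s hs t ht => hab t (lt_trans (lt_min hs one_pos) ht.1)) (hMint1 1 one_pos)
      (fun t ht => hvi.smul _) (fun t ht => by
        rw [integral_smul, hu_cancel, smul_zero])).1
    simpa only [integral_smul] using h
  have hV : ∀ t > 0, ∫ r in Ioo (0 : ℝ) t, ((A r - w r) / r) • ∫ s in Ioo (0 : ℝ) r, v s
      = ∫ s in Ioo (0:ℝ) t, (A s - A t) • v s := by
    intro t ht
    have h := (keyG (fun _ r => (Iio t).indicator (fun r => (A r - w r) / r) r) v (fun _ => C) ht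
      (ham.indicator measurableSet_Iio).comp_snd hvm
      (fun s hs r hr => by
        have h0 : 0 < r := lt_trans (lt_min hs ht) hr.1
        by_cases h : r ∈ Iio t
        · simpa only [indicator_of_mem h] using hab r h0
        · simp only [indicator_of_notMem h, abs_zero]
          positivity) (hMint1 t ht)
      (fun t ht => hvi.smul _) (fun t ht => by
        rw [integral_smul, hu_cancel, smul_zero])).2
    simp only [integral_smul] at h
    have e1 : ∀ f : ℝ → E, ∫ r in Ioo (0:ℝ) t, f r = ∫ r in Ioi (0:ℝ), (Iio t).indicator f r := by
      intro f
      rw [integral_indicator measurableSet_Iio, Measure.restrict_restrict measurableSet_Iio,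
        inter_comm, Ioi_inter_Iio]
    rw [e1, e1]
    trans ∫ r in Ioi (0:ℝ), (Iio t).indicator (fun r => (A r - w r) / r) r •
      ∫ s in Ioo (0 : ℝ) r, v s
    · congr 1
      ext r
      simp only [indicator_apply]
      split_ifs <;> simp
    rw [h]
    apply setIntegral_congr_fun measurableSet_Ioi
    intro s hs
    have hs : 0 < s := hs
    simp only
    rcases lt_or_ge s t with hst | hst
    · rw [indicator_of_mem (show s ∈ Iio t from hst), ← ftc1 w hwInt hs ht]
      congr 1
      apply intervalIntegral.integral_congr_ae
      filter_upwards [Measure.ae_ne volume t] with r hr hrm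
      rw [uIoc_of_le hst.le] at hrm
      exact indicator_of_mem (show r ∈ Iio t from lt_of_le_of_ne hrm.2 hr) _
    · rw [indicator_of_notMem (by simpa using hst)]
      have : ∫ r in s..t, (Iio t).indicator (fun r => (A r - w r) / r) r = ∫ r in s..t, (0:ℝ) := by
        apply intervalIntegral.integral_congr_ae
        filter_upwards with r hrm
        rw [uIoc_of_ge hst] at hrm
        exact indicator_of_notMem (show r ∉ Iio t by simpa using hrm.1.le) _
      rw [this]
      simp
  have hmeas2 : AEStronglyMeasurable (fun p : ℝ × ℝ => (A p.2 - w p.2) / p.2 * (A p.1 - A p.2))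
      ((volume.restrict (Ioi 0)).prod (volume.restrict (Ioi 0))) :=
    (ham.comp_snd).mul (hAm.comp_fst.sub hAm.comp_snd)
  have h2 := keyG (fun s t => (A t - w t) / t * (A s - A t)) v
    (fun s => C * (C * |Real.log s - Real.log 1|)) one_pos hmeas2 hvm
    (fun s hs t ht => by
      have h0 : 0 < t := lt_trans (lt_min hs one_pos) ht.1
      rw [abs_mul]
      have h1 := hab t h0
      have h3 := hlip hs h0
      have h4 : |Real.log s - Real.log t| ≤ |Real.log s - Real.log 1| := by
        rcases mem_uIoc.mp ht with ⟨h5, h6⟩ | ⟨h5, h6⟩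
        · have := Real.log_le_log hs h5.le
          have := Real.log_le_log h0 h6
          rw [abs_of_nonpos (by linarith), abs_of_nonpos (by linarith)]
          linarith
        · have := Real.log_le_log h0 h6
          have := Real.log_le_log one_pos h5.le
          rw [abs_of_nonneg (by linarith), abs_of_nonneg (by linarith)]
          linarith
      calc _ ≤ (C * t⁻¹) * (C * |Real.log s - Real.log 1|) := by
            gcongr
            exact h3.trans (by gcongr)
        _ = _ := by ring) hMint2
    (fun t ht => by
      simp only [mul_smul, sub_smul]
      exact (hAvi.sub (hvi.smul (A t))).smul ((A t - w t) / t))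
    (fun t ht => by
      simp only [mul_smul, sub_smul]
      have i0 : IntegrableOn (fun s => A t • v s) (Ioi 0) := hvi.smul (A t)
      rw [integral_smul, integral_sub hAvi i0, integral_smul, hAv0,
        show ∫ s in Ioi (0:ℝ), v s = 0 from hu_cancel]
      simp)
  have hH : EqOn (fun t => ∫ s in Ioo (0:ℝ) t, ((A t - w t) / t * (A s - A t)) • v s)
      (fun t => ((A t - w t) / t) •
        ∫ r in Ioo (0 : ℝ) t, ((A r - w r) / r) • ∫ s in Ioo (0 : ℝ) r, v s) (Ioi 0) := by
    intro t ht
    simp only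
    rw [hV t ht, ← integral_smul]
    simp only [mul_smul]
  have hsq : ∀ s, ((A s) ^ 2 / s) • u s = (A s) ^ 2 • v s := fun s => by
    simp only [v, smul_smul, div_eq_mul_inv]
  simp only [hsq]
  refine ⟨hA2vi, hU, h2.1.congr_fun hH measurableSet_Ioi, ?_⟩
  have h3 := h2.2
  rw [setIntegral_congr_fun measurableSet_Ioi hH] at h3
  change _ = (2:ℝ) • ∫ t in Ioi (0:ℝ), ((A t - w t) / t) •
        ∫ r in Ioo (0 : ℝ) t, ((A r - w r) / r) • ∫ s in Ioo (0 : ℝ) r, v s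
  rw [h3, ← integral_smul]
  have h4 : EqOn (fun s => (2:ℝ) • (∫ t in s..1, (A t - w t) / t * (A s - A t)) • v s)
      (fun s => (A s) ^ 2 • v s - (2 * A 1) • (A s • v s) + (A 1) ^ 2 • v s) (Ioi 0) := by
    intro s hs
    simp only
    rw [ftc2 w hwInt hs one_pos]
    generalize v s = z
    rw [smul_smul, smul_smul, ← sub_smul, ← add_smul]
    congr 1
    ring
  have i1 : IntegrableOn (fun s => (2 * A 1) • (A s • v s)) (Ioi 0) := hAvi.smul (2 * A 1)
  have i2 : IntegrableOn (fun s => (A 1) ^ 2 • v s) (Ioi 0) := hvi.smul (A 1 ^ 2)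
  have i3 : IntegrableOn (fun s => (A s) ^ 2 • v s - (2 * A 1) • (A s • v s)) (Ioi 0) :=
    hA2vi.sub i1
  rw [setIntegral_congr_fun measurableSet_Ioi h4, integral_add i3 i2,
    integral_sub hA2vi i1, integral_smul, integral_smul, hAv0,
    show ∫ s in Ioi (0:ℝ), v s = 0 from hu_cancel]
  simp
end
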